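/- Let R > 0 and let u₀ ∈ 𝓗² satisfy Θ_R u₀ = u₀ and ‖u₁(0)‖² + ‖u₂(0)‖² = 1; let u be the solution of the nonlinear Landau–Zener system with datum u₀, v its gauge transform, and set v^±(s) = Π^±(s)v(s). Then there exist Ω⁺, Ω⁻, A⁺, A⁻ ∈ [0,1] and a constant C > 0 (depending only on R and the fixed data θ, δ, f₁, f₂, G) such that |‖v^+(s)‖² − Ω⁺| ≤ C/s² and |‖v^-(s)‖² − Ω⁻| ≤ C/s² for all s ≥ 1, and |‖v^+(s)‖² − A⁺| ≤ C/s² and |‖v^-(s)‖² − A⁻| ≤ C/s² for all s ≤ −1. -/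

import Mathlib

open ContinuousLinearMap Complex Filter Topology
open scoped InnerProductSpace

noncomputable section

variable {H : Type*} [NormedAddCommGroup H] [InnerProductSpace ℂ H] [CompleteSpace H]

/-- Functional calculus `χ(A)` of a selfadjoint operator `A` for a complex-valued
function `χ : ℝ → ℂ` (defined via the real continuous functional calculus applied to
the real and imaginary parts of `χ`). -/
def fc (χ : ℝ → ℂ) (A : H →L[ℂ] H) : H →L[ℂ] H :=
  cfc (fun x : ℝ => (χ x).re) A + Complex.I • cfc (fun x : ℝ => (χ x).im) A

/-- The commutation assumption: for every continuous `χ : ℝ → ℂ`,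
`χ(GG*)G = Gχ(G*G)` and `χ(G*G)G* = G*χ(GG*)`. -/
def CommHyp (G : H →L[ℂ] H) : Prop :=
  ∀ χ : ℝ → ℂ, Continuous χ →
    (fc χ (G * ContinuousLinearMap.adjoint G)) ∘L G
        = G ∘L (fc χ (ContinuousLinearMap.adjoint G * G)) ∧
    (fc χ (ContinuousLinearMap.adjoint G * G)) ∘L ContinuousLinearMap.adjoint G
        = ContinuousLinearMap.adjoint G ∘L (fc χ (G * ContinuousLinearMap.adjoint G))

/-- The equivalence between `𝓗²` (with its Hilbert space structure) and `𝓗 × 𝓗`. -/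
def eqv : WithLp 2 (H × H) ≃L[ℂ] H × H := WithLp.prodContinuousLinearEquiv 2 ℂ H H

/-- The operator `V(s)(w₁,w₂) = (s·w₁ + Gw₂, G*w₁ − s·w₂)` on `𝓗²`. -/
def Vop (G : H →L[ℂ] H) (s : ℝ) : WithLp 2 (H × H) →L[ℂ] WithLp 2 (H × H) :=
  (eqv (H := H)).symm.toContinuousLinearMap ∘L
    ((((s : ℂ) • ContinuousLinearMap.fst ℂ H H + G ∘L ContinuousLinearMap.snd ℂ H H)).prod
      ((ContinuousLinearMap.adjoint G) ∘L ContinuousLinearMap.fst ℂ H H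
        - (s : ℂ) • ContinuousLinearMap.snd ℂ H H)) ∘L
    (eqv (H := H)).toContinuousLinearMap

/-- `F₁(u) = f₁(‖u₁‖², ‖u₂‖²)`. -/
def F1 (f₁ : ℝ × ℝ → ℝ) (u : WithLp 2 (H × H)) : ℝ := f₁ (‖u.fst‖ ^ 2, ‖u.snd‖ ^ 2)

/-- `F₂(u) = f₂(‖u₁‖², ‖u₂‖²)`. -/
def F2 (f₂ : ℝ × ℝ → ℝ) (u : WithLp 2 (H × H)) : ℝ := f₂ (‖u.fst‖ ^ 2, ‖u.snd‖ ^ 2)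

/-- The nonlinear term `F(u)u = (F₁(u)u₁, F₂(u)u₂)`. -/
def nlt (f₁ f₂ : ℝ × ℝ → ℝ) (u : WithLp 2 (H × H)) : WithLp 2 (H × H) :=
  (WithLp.equiv 2 (H × H)).symm ((F1 f₁ u) • u.fst, (F2 f₂ u) • u.snd)

/-- `u` is a (global, `C¹`) solution of `−i u′(s) = V(s)u(s) + δ F(u(s))u(s)`:
equivalently, `u′(s) = i (V(s)u(s) + δ F(u(s))u(s))` for all `s`. -/
def IsLZSol (G : H →L[ℂ] H) (δ : ℝ) (f₁ f₂ : ℝ × ℝ → ℝ) (u : ℝ → WithLp 2 (H × H)) : Prop :=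
  ∀ s : ℝ, HasDerivAt u (Complex.I • (Vop G s (u s) + δ • nlt f₁ f₂ (u s))) s

/-- `f ∈ C²(ℝ²;ℝ)` with bounded second derivative. -/
def C2Bdd (f : ℝ × ℝ → ℝ) : Prop :=
  ContDiff ℝ 2 f ∧ ∃ C : ℝ, ∀ p : ℝ × ℝ, ‖iteratedFDeriv ℝ 2 f p‖ ≤ C

/-- `θ ∈ C_c^∞(ℝ;ℝ)`, `0 ≤ θ ≤ 1`, `θ = 1` on `(−1/2,1/2)` and `θ = 0` outside `[−1,1]`. -/
def IsCutoff (θ : ℝ → ℝ) : Prop :=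
  ContDiff ℝ (⊤ : ℕ∞) θ ∧ HasCompactSupport θ ∧ (∀ x, 0 ≤ θ x ∧ θ x ≤ 1) ∧
    (∀ x, |x| < 1/2 → θ x = 1) ∧ (∀ x, 1 < |x| → θ x = 0)

/-- The cutoff operator `Θ_R = diag(θ(GG*/R²), θ(G*G/R²))`. -/
def Theta (G : H →L[ℂ] H) (θ : ℝ → ℝ) (R : ℝ) :
    WithLp 2 (H × H) →L[ℂ] WithLp 2 (H × H) :=
  (eqv (H := H)).symm.toContinuousLinearMap ∘L
    ((cfc (fun x : ℝ => θ (x / R ^ 2)) (G * ContinuousLinearMap.adjoint G)).prodMap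
      (cfc (fun x : ℝ => θ (x / R ^ 2)) (ContinuousLinearMap.adjoint G * G))) ∘L
    (eqv (H := H)).toContinuousLinearMap

/-- The phase `φ(s,λ) = s²/2 + (λ/2)·log|s|`. -/
def phase (s lam : ℝ) : ℝ := s ^ 2 / 2 + lam / 2 * Real.log |s|

/-- The unitary operator `e^{iφ(s,GG*)}` on `𝓗`. -/
def ePhaseP (G : H →L[ℂ] H) (s : ℝ) : H →L[ℂ] H :=
  fc (fun lam => Complex.exp (Complex.I * (phase s lam))) (G * ContinuousLinearMap.adjoint G)

/-- The unitary operator `e^{−iφ(s,G*G)}` on `𝓗`. -/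
def ePhaseM (G : H →L[ℂ] H) (s : ℝ) : H →L[ℂ] H :=
  fc (fun lam => Complex.exp (-(Complex.I * (phase s lam))))
    (ContinuousLinearMap.adjoint G * G)

/-- The model asymptotic first component `e^{iδF₁(ω)s + iϕ}·e^{iφ(s,GG*)}ω₁`. -/
def asym1 (G : H →L[ℂ] H) (δ : ℝ) (f₁ : ℝ × ℝ → ℝ) (ω : WithLp 2 (H × H)) (ϕ : ℝ)
    (s : ℝ) : H :=
  Complex.exp (Complex.I * (δ * F1 f₁ ω * s + ϕ)) • (ePhaseP G s ω.fst)

/-- The model asymptotic second component `e^{iδF₂(ω)s − iϕ}·e^{−iφ(s,G*G)}ω₂`. -/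
def asym2 (G : H →L[ℂ] H) (δ : ℝ) (f₂ : ℝ × ℝ → ℝ) (ω : WithLp 2 (H × H)) (ϕ : ℝ)
    (s : ℝ) : H :=
  Complex.exp (Complex.I * (δ * F2 f₂ ω * s - ϕ)) • (ePhaseM G s ω.snd)

/-- `α` is the incoming scattering state (at `s → −∞`) of `u`, with phase shift `ϕ`. -/
def Incoming (G : H →L[ℂ] H) (δ : ℝ) (f₁ f₂ : ℝ × ℝ → ℝ) (α : WithLp 2 (H × H)) (ϕ : ℝ)
    (u : ℝ → WithLp 2 (H × H)) : Prop :=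
  Tendsto (fun s => ‖(u s).fst - asym1 G δ f₁ α ϕ s‖ + ‖(u s).snd - asym2 G δ f₂ α ϕ s‖)
    atBot (𝓝 0)

/-- `ω` is the outgoing scattering state (at `s → +∞`) of `u`, with phase shift `ϕ`. -/
def Outgoing (G : H →L[ℂ] H) (δ : ℝ) (f₁ f₂ : ℝ × ℝ → ℝ) (ω : WithLp 2 (H × H)) (ϕ : ℝ)
    (u : ℝ → WithLp 2 (H × H)) : Prop :=
  Tendsto (fun s => ‖(u s).fst - asym1 G δ f₁ ω ϕ s‖ + ‖(u s).snd - asym2 G δ f₂ ω ϕ s‖)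
    atTop (𝓝 0)

/-- `M(u) = (δ/2)(F₁(u) + F₂(u))`. -/
def Mscal (δ : ℝ) (f₁ f₂ : ℝ × ℝ → ℝ) (u : WithLp 2 (H × H)) : ℝ :=
  δ / 2 * (F1 f₁ u + F2 f₂ u)

/-- `m(u) = (δ/2)(F₁(u) − F₂(u))`. -/
def mscal (δ : ℝ) (f₁ f₂ : ℝ × ℝ → ℝ) (u : WithLp 2 (H × H)) : ℝ :=
  δ / 2 * (F1 f₁ u - F2 f₂ u)

/-- The gauge transform `v(s) = e^{−i∫₀ˢ M(u(τ))dτ}·u(s)`. -/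
def gaugeT (δ : ℝ) (f₁ f₂ : ℝ × ℝ → ℝ) (u : ℝ → WithLp 2 (H × H)) :
    ℝ → WithLp 2 (H × H) :=
  fun s => Complex.exp (-(Complex.I * (∫ τ in (0:ℝ)..s, Mscal δ f₁ f₂ (u τ)))) • u s

/-- `σ(s) = s + m(u(s))`. -/
def sigma (δ : ℝ) (f₁ f₂ : ℝ × ℝ → ℝ) (u : ℝ → WithLp 2 (H × H)) (s : ℝ) : ℝ :=
  s + mscal δ f₁ f₂ (u s)

/-- The operator `Λ_t = diag((t² + GG*)^{1/2}, (t² + G*G)^{1/2})` on `𝓗²`. -/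
def LamOp (G : H →L[ℂ] H) (t : ℝ) : WithLp 2 (H × H) →L[ℂ] WithLp 2 (H × H) :=
  (eqv (H := H)).symm.toContinuousLinearMap ∘L
    ((cfc (fun x : ℝ => Real.sqrt (t ^ 2 + x)) (G * ContinuousLinearMap.adjoint G)).prodMap
      (cfc (fun x : ℝ => Real.sqrt (t ^ 2 + x)) (ContinuousLinearMap.adjoint G * G))) ∘L
    (eqv (H := H)).toContinuousLinearMap

/-- The operator `Λ_t⁻¹ = diag((t² + GG*)^{-1/2}, (t² + G*G)^{-1/2})` on `𝓗²`. -/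
def LamInv (G : H →L[ℂ] H) (t : ℝ) : WithLp 2 (H × H) →L[ℂ] WithLp 2 (H × H) :=
  (eqv (H := H)).symm.toContinuousLinearMap ∘L
    ((cfc (fun x : ℝ => (Real.sqrt (t ^ 2 + x))⁻¹)
        (G * ContinuousLinearMap.adjoint G)).prodMap
      (cfc (fun x : ℝ => (Real.sqrt (t ^ 2 + x))⁻¹)
        (ContinuousLinearMap.adjoint G * G))) ∘L
    (eqv (H := H)).toContinuousLinearMap

/-- The projection `Π_t^+ = (1/2)(Id + Λ_t⁻¹V(t))`. -/
def PiP (G : H →L[ℂ] H) (t : ℝ) : WithLp 2 (H × H) →L[ℂ] WithLp 2 (H × H) :=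
  (2 : ℂ)⁻¹ • (1 + LamInv G t ∘L Vop G t)

/-- The projection `Π_t^- = (1/2)(Id − Λ_t⁻¹V(t))`. -/
def PiM (G : H →L[ℂ] H) (t : ℝ) : WithLp 2 (H × H) →L[ℂ] WithLp 2 (H × H) :=
  (2 : ℂ)⁻¹ • (1 - LamInv G t ∘L Vop G t)

/-- `m̃(x,y) = (δ/2)(f₁(x,y) − f₂(x,y))`. -/
def mtilde (δ : ℝ) (f₁ f₂ : ℝ × ℝ → ℝ) : ℝ × ℝ → ℝ := fun p => δ / 2 * (f₁ p - f₂ p)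

/-- `m̲(s) = (∂₁m̃ − ∂₂m̃)(‖v₁(s)‖², ‖v₂(s)‖²)`. -/
def mbar (δ : ℝ) (f₁ f₂ : ℝ × ℝ → ℝ) (v : ℝ → WithLp 2 (H × H)) (s : ℝ) : ℝ :=
  fderiv ℝ (mtilde δ f₁ f₂) (‖(v s).fst‖ ^ 2, ‖(v s).snd‖ ^ 2) (1, 0) -
    fderiv ℝ (mtilde δ f₁ f₂) (‖(v s).fst‖ ^ 2, ‖(v s).snd‖ ^ 2) (0, 1)


/-- The operator `A(a,b,c,d)(w₁,w₂) = (a(GG*)w₁ + b(GG*)Gw₂, c(G*G)G*w₁ + d(G*G)w₂)`. -/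
def Aop (G : H →L[ℂ] H) (a b c d : ℝ → ℂ) :
    WithLp 2 (H × H) →L[ℂ] WithLp 2 (H × H) :=
  (eqv (H := H)).symm.toContinuousLinearMap ∘L
    (((fc a (G * ContinuousLinearMap.adjoint G)) ∘L ContinuousLinearMap.fst ℂ H H
        + (fc b (G * ContinuousLinearMap.adjoint G)) ∘L G ∘L ContinuousLinearMap.snd ℂ H H).prod
      ((fc c (ContinuousLinearMap.adjoint G * G)) ∘L (ContinuousLinearMap.adjoint G)
          ∘L ContinuousLinearMap.fst ℂ H H
        + (fc d (ContinuousLinearMap.adjoint G * G)) ∘L ContinuousLinearMap.snd ℂ H H)) ∘L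
    (eqv (H := H)).toContinuousLinearMap

/-- The operator `𝒦(w₁,w₂) = (−Gw₂, G*w₁)` on `𝓗²`. -/
def Kcal (G : H →L[ℂ] H) : WithLp 2 (H × H) →L[ℂ] WithLp 2 (H × H) :=
  (eqv (H := H)).symm.toContinuousLinearMap ∘L
    ((-(G ∘L ContinuousLinearMap.snd ℂ H H)).prod
      ((ContinuousLinearMap.adjoint G) ∘L ContinuousLinearMap.fst ℂ H H)) ∘L
    (eqv (H := H)).toContinuousLinearMap



theorem exists_abs_sub_le_of_abs_deriv_le_div_cube {Q Q' : ℝ → ℝ} {T C : ℝ} (hT : 0 < T)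
    (hQ : ∀ s, T ≤ s → HasDerivAt Q (Q' s) s) (hQ' : ∀ s, T ≤ s → |Q' s| ≤ C / s ^ 3) :
    ∃ L : ℝ, ∀ s, T ≤ s → |Q s - L| ≤ C / s ^ 2 := by
  have hC : 0 ≤ C := by
    have h := (abs_nonneg _).trans (hQ' T le_rfl)
    rcases div_nonneg_iff.mp h with h | h
    · exact h.1
    · exact absurd h.2 (not_le.mpr (by positivity))
  have hr : ∀ s, T ≤ s → HasDerivAt (fun s : ℝ => C / 2 / s ^ 2) (-(C / s ^ 3)) s := by
    intro s hs
    have hs0 : s ≠ 0 := (hT.trans_le hs).ne'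
    have := (hasDerivAt_const s (C / 2)).div (hasDerivAt_pow 2 s) (pow_ne_zero 2 hs0)
    refine HasDerivAt.congr_deriv this ?_
    push_cast
    field_simp
    ring
  have hmono : MonotoneOn (fun s => Q s - C / 2 / s ^ 2) (Set.Ici T) := by
    apply monotoneOn_of_hasDerivWithinAt_nonneg (convex_Ici T)
      (f' := fun s => Q' s - -(C / s ^ 3))
    · exact fun s hs => ((hQ s hs).sub (hr s hs)).continuousAt.continuousWithinAt
    · intro s hs
      rw [interior_Ici] at hs
      exact ((hQ s hs.le).sub (hr s hs.le)).hasDerivWithinAt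
    · intro s hs
      rw [interior_Ici] at hs
      linarith [(abs_le.mp (hQ' s hs.le)).1]
  have hanti : AntitoneOn (fun s => Q s + C / 2 / s ^ 2) (Set.Ici T) := by
    apply antitoneOn_of_hasDerivWithinAt_nonpos (convex_Ici T)
      (f' := fun s => Q' s + -(C / s ^ 3))
    · exact fun s hs => ((hQ s hs).add (hr s hs)).continuousAt.continuousWithinAt
    · intro s hs
      rw [interior_Ici] at hs
      exact ((hQ s hs.le).add (hr s hs.le)).hasDerivWithinAt
    · intro s hs
      rw [interior_Ici] at hs
      linarith [(abs_le.mp (hQ' s hs.le)).2]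
  have hle : ∀ r s, T ≤ r → T ≤ s → Q r - C / 2 / r ^ 2 ≤ Q s + C / 2 / s ^ 2 := by
    intro r s hr hs
    have hm : T ≤ max r s := le_max_of_le_left hr
    have h1 := hmono hr hm (le_max_left r s)
    have h2 := hanti hs hm (le_max_right r s)
    have h3 : 0 ≤ C / 2 / (max r s) ^ 2 := by positivity
    beta_reduce at h1 h2
    linarith
  refine ⟨sSup ((fun s => Q s - C / 2 / s ^ 2) '' Set.Ici T), fun s hs => ?_⟩
  have hub : ∀ y ∈ (fun s => Q s - C / 2 / s ^ 2) '' Set.Ici T, y ≤ Q s + C / 2 / s ^ 2 := by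
    rintro _ ⟨r, hr, rfl⟩
    exact hle r s hr hs
  have h1 := le_csSup ⟨_, hub⟩ (Set.mem_image_of_mem _ (Set.mem_Ici.mpr hs))
  have h2 := csSup_le ⟨_, Set.mem_image_of_mem _ (Set.mem_Ici.mpr hs)⟩ hub
  have h3 : 0 ≤ C / s ^ 2 := by positivity
  have h4 : C / 2 / s ^ 2 = C / s ^ 2 / 2 := by ring
  beta_reduce at h1
  rw [abs_le]
  constructor <;> linarith

/-- Averaging for the scalar system satisfied by the mass `a = ‖u₁‖²` and the real and imaginary
parts `X`, `Y` of the correlation `⟪u₁, G u₂⟫`. -/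
theorem exists_limit_of_mass_system {B D : ℝ} (hB : 0 ≤ B) (hD : 0 ≤ D) :
    ∃ C > 0, ∀ g g₁ g₂ a X Y κ σ : ℝ → ℝ,
      (∀ x, HasDerivAt g (g₁ x) x) → (∀ x, HasDerivAt g₁ (g₂ x) x) →
      (∀ x ∈ Set.Icc (0 : ℝ) 1, |g x| ≤ D ∧ |g₁ x| ≤ D ∧ |g₂ x| ≤ D) →
      (∀ s, a s ∈ Set.Icc (0 : ℝ) 1) → (∀ s, |X s| ≤ B) → (∀ s, |Y s| ≤ B) →
      (∀ s, |κ s| ≤ B) → (∀ s, σ s = s + g (a s)) →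
      (∀ s, HasDerivAt a (-2 * Y s) s) → (∀ s, HasDerivAt X (2 * σ s * Y s) s) →
      (∀ s, HasDerivAt Y (-2 * σ s * X s + κ s) s) →
      ∃ L ∈ Set.Icc (-1 : ℝ) 1, ∀ s, 2 * (D + 1) ≤ s →
        |2 * a s - 1 + 2 * X s / σ s - L| ≤ C / s ^ 2 := by
  set C₀ := B + 3 * B * (1 + 2 * D * B) + 2 * D * B * B ^ 2 + 3 * D * B ^ 2 * (1 + 2 * D * B)
    with hC₀
  refine ⟨8 * C₀ + 8 * (B + D * B ^ 2) + 1, by positivity, ?_⟩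
  intro g g₁ g₂ a X Y κ σ hg hg₁ hb ha hX hY hκ hσ hda hdX hdY
  have hσ2 : ∀ s, 2 * (D + 1) ≤ s → s / 2 ≤ σ s := by
    intro s hs
    have := (abs_le.mp (hb _ (ha s)).1).1
    rw [hσ]
    linarith
  have hdσ : ∀ s, HasDerivAt σ (1 + g₁ (a s) * (-2 * Y s)) s := by
    intro s
    have h : HasDerivAt (fun s => s + g (a s)) (1 + g₁ (a s) * (-2 * Y s)) s :=
      (hasDerivAt_id s).add ((hg (a s)).comp s (hda s))
    rwa [← funext hσ] at h
  have hdg : ∀ s, HasDerivAt (fun s => g₁ (a s)) (g₂ (a s) * (-2 * Y s)) s :=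
    fun s => (hg₁ (a s)).comp s (hda s)
  set Q : ℝ → ℝ := fun s => 2 * a s - 1 + 2 * X s / σ s
    - (Y s + g₁ (a s) * X s ^ 2) / σ s ^ 3 with hQ
  have hdQ : ∀ s, 2 * (D + 1) ≤ s → HasDerivAt Q
      ((-κ s + 3 * Y s * (1 + g₁ (a s) * (-2 * Y s)) / σ s - g₂ (a s) * (-2 * Y s) * X s ^ 2
        + 3 * g₁ (a s) * X s ^ 2 * (1 + g₁ (a s) * (-2 * Y s)) / σ s) / σ s ^ 3) s := by
    intro s hs
    have hs0 : σ s ≠ 0 := by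
      have := hσ2 s hs
      exact ne_of_gt (by linarith)
    have h := ((((hda s).const_mul 2).sub_const 1).add
      (((hdX s).const_mul 2).div (hdσ s) hs0)).sub
      (((hdY s).add ((hdg s).mul ((hdX s).pow 2))).div ((hdσ s).pow 3) (pow_ne_zero 3 hs0))
    refine HasDerivAt.congr_deriv h ?_
    simp only [Pi.mul_apply, Pi.pow_apply, Pi.add_apply]
    field_simp
    push_cast
    ring
  have hQ' : ∀ s, 2 * (D + 1) ≤ s →
      |(-κ s + 3 * Y s * (1 + g₁ (a s) * (-2 * Y s)) / σ s - g₂ (a s) * (-2 * Y s) * X s ^ 2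
        + 3 * g₁ (a s) * X s ^ 2 * (1 + g₁ (a s) * (-2 * Y s)) / σ s) / σ s ^ 3|
        ≤ 8 * C₀ / s ^ 3 := by
    intro s hs
    have hs1 : 1 ≤ σ s := by have := hσ2 s hs; linarith
    have hs0 : 0 < s := by linarith
    obtain ⟨-, hD1, hD2⟩ := hb _ (ha s)
    have hp : |1 + g₁ (a s) * (-2 * Y s)| ≤ 1 + 2 * D * B := by
      refine (abs_add_le _ _).trans ?_
      rw [abs_one, abs_mul, abs_mul, abs_neg, abs_two]
      nlinarith [mul_le_mul hD1 (hY s) (abs_nonneg _) hD]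
    have hdiv : ∀ x y : ℝ, |x| ≤ y → |x / σ s| ≤ y := by
      intro x y hxy
      rw [abs_div, abs_of_pos (by linarith : 0 < σ s)]
      exact (div_le_self (abs_nonneg _) hs1).trans hxy
    have hX2 : |X s ^ 2| ≤ B ^ 2 := by
      rw [abs_pow]; exact pow_le_pow_left₀ (abs_nonneg _) (hX s) 2
    have e2 : |3 * Y s * (1 + g₁ (a s) * (-2 * Y s)) / σ s| ≤ 3 * B * (1 + 2 * D * B) := by
      apply hdiv
      rw [abs_mul, abs_mul, abs_of_pos (by norm_num : (0 : ℝ) < 3)]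
      gcongr
      exact hY s
    have e3 : |g₂ (a s) * (-2 * Y s) * X s ^ 2| ≤ 2 * D * B * B ^ 2 := by
      rw [abs_mul, abs_mul, abs_mul, abs_neg, abs_two]
      have : |g₂ (a s)| * (2 * |Y s|) ≤ 2 * D * B := by
        nlinarith [mul_le_mul hD2 (hY s) (abs_nonneg _) hD]
      gcongr
    have e4 : |3 * g₁ (a s) * X s ^ 2 * (1 + g₁ (a s) * (-2 * Y s)) / σ s|
        ≤ 3 * D * B ^ 2 * (1 + 2 * D * B) := by
      apply hdiv
      rw [abs_mul, abs_mul, abs_mul, abs_of_pos (by norm_num : (0 : ℝ) < 3)]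
      gcongr
    have hC₀0 : 0 ≤ C₀ := by positivity
    rw [abs_div, abs_of_pos (by positivity : 0 < σ s ^ 3), div_le_div_iff₀ (by positivity)
      (by positivity)]
    have hnum : |-κ s + 3 * Y s * (1 + g₁ (a s) * (-2 * Y s)) / σ s
        - g₂ (a s) * (-2 * Y s) * X s ^ 2
        + 3 * g₁ (a s) * X s ^ 2 * (1 + g₁ (a s) * (-2 * Y s)) / σ s| ≤ C₀ := by
      have e1 := abs_le.mp (hκ s)
      rw [abs_le] at e2 e3 e4 ⊢
      constructor <;> linarith
    have hcube : s ^ 3 ≤ 8 * σ s ^ 3 := by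
      have := pow_le_pow_left₀ (by positivity) (hσ2 s hs) 3
      calc s ^ 3 = 8 * (s / 2) ^ 3 := by ring
        _ ≤ _ := by linarith
    calc _ ≤ C₀ * (8 * σ s ^ 3) := mul_le_mul hnum hcube (by positivity) hC₀0
      _ = _ := by ring
  obtain ⟨L, hL⟩ := exists_abs_sub_le_of_abs_deriv_le_div_cube (by linarith) hdQ hQ'
  have hmain : ∀ s, 2 * (D + 1) ≤ s → |2 * a s - 1 + 2 * X s / σ s - L|
      ≤ (8 * C₀ + 8 * (B + D * B ^ 2) + 1) / s ^ 2 := by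
    intro s hs
    have hs0 : 0 < s := by linarith
    have hs1 : 1 ≤ s := by linarith
    have hσ0 : 0 < σ s := by have := hσ2 s hs; linarith
    have hrem : |(Y s + g₁ (a s) * X s ^ 2) / σ s ^ 3| ≤ 8 * (B + D * B ^ 2) / s ^ 2 := by
      rw [abs_div, abs_of_pos (by positivity : 0 < σ s ^ 3), div_le_div_iff₀ (by positivity)
        (by positivity)]
      have hnum : |Y s + g₁ (a s) * X s ^ 2| ≤ B + D * B ^ 2 := by
        refine (abs_add_le _ _).trans ?_
        rw [abs_mul, abs_pow]
        gcongr
        · exact hY s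
        · exact (hb _ (ha s)).2.1
        · exact hX s
      have hcube : s ^ 2 ≤ 8 * σ s ^ 3 := by
        have := pow_le_pow_left₀ (by positivity) (hσ2 s hs) 3
        calc s ^ 2 ≤ s ^ 3 := pow_le_pow_right₀ hs1 (by norm_num)
          _ = 8 * (s / 2) ^ 3 := by ring
          _ ≤ _ := by linarith
      calc _ ≤ (B + D * B ^ 2) * (8 * σ s ^ 3) := mul_le_mul hnum hcube (by positivity)
            (by positivity)
        _ = _ := by ring
    have h1 := hL s hs
    have h3 : (8 * C₀ + 8 * (B + D * B ^ 2) + 1) / s ^ 2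
        = 8 * C₀ / s ^ 2 + 8 * (B + D * B ^ 2) / s ^ 2 + 1 / s ^ 2 := by ring
    have h4 : 0 ≤ 1 / s ^ 2 := by positivity
    rw [h3]
    simp only [hQ] at h1
    rw [abs_le] at h1 hrem ⊢
    constructor <;> linarith
  refine ⟨L, ?_, hmain⟩
  set C₁ := 8 * C₀ + 8 * (B + D * B ^ 2) + 1
  have hC₁ : 0 ≤ C₁ := by positivity
  have hlim : Tendsto (fun s : ℝ => 1 + (C₁ + 4 * B) / s) atTop (𝓝 1) := by
    simpa using (tendsto_const_nhds (x := (1 : ℝ))).add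
      ((tendsto_const_nhds (x := C₁ + 4 * B)).div_atTop tendsto_id)
  have hbd : ∀ s, 2 * (D + 1) ≤ s → |L| ≤ 1 + (C₁ + 4 * B) / s := by
    intro s hs
    have hs0 : 0 < s := by linarith
    have hs1 : 1 ≤ s := by linarith
    have hσ0 : 0 < σ s := by have := hσ2 s hs; linarith
    have h1 := hmain s hs
    have h2 : C₁ / s ^ 2 ≤ C₁ / s := by
      gcongr
      nlinarith
    have h3 : |2 * X s / σ s| ≤ 4 * B / s := by
      rw [abs_div, abs_of_pos hσ0, abs_mul, abs_two, div_le_div_iff₀ hσ0 hs0]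
      nlinarith [mul_le_mul (hX s) (hσ2 s hs) (by positivity) hB]
    have h4 := ha s
    rw [add_div]
    rw [abs_le] at h1 h3 ⊢
    constructor <;> linarith [h4.1, h4.2]
  exact abs_le.mp (ge_of_tendsto hlim ((eventually_ge_atTop _).mono hbd))

theorem exists_spectrum_bounds {A : H →L[ℂ] H} (hA : 0 ≤ A) (hu : IsUnit A) :
    ∃ N > 0, ∀ x ∈ spectrum ℝ A, 0 < x ∧ x ≤ N ∧ (Real.sqrt x)⁻¹ ≤ N := by
  have hpos : ∀ x ∈ spectrum ℝ A, 0 < x := fun x hx =>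
    lt_of_le_of_ne (spectrum_nonneg_of_nonneg hA hx) fun h =>
      spectrum.zero_notMem ℝ hu (h ▸ hx)
  have hK : IsCompact (spectrum ℝ A) := ContinuousFunctionalCalculus.isCompact_spectrum A
  obtain ⟨N₁, hN₁⟩ := hK.exists_bound_of_continuousOn (f := fun x : ℝ => x) continuousOn_id
  obtain ⟨N₂, hN₂⟩ := hK.exists_bound_of_continuousOn (f := fun x : ℝ => (Real.sqrt x)⁻¹)
    (Real.continuous_sqrt.continuousOn.inv₀ fun x hx => (Real.sqrt_pos.mpr (hpos x hx)).ne')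
  refine ⟨max 1 (max N₁ N₂), lt_max_of_lt_left one_pos, fun x hx => ⟨hpos x hx, ?_, ?_⟩⟩
  · exact ((le_abs_self x).trans (hN₁ x hx)).trans ((le_max_left _ _).trans (le_max_right _ _))
  · exact ((le_abs_self _).trans (hN₂ x hx)).trans ((le_max_right _ _).trans (le_max_right _ _))

theorem exists_norm_cfc_inv_sqrt_le {A : H →L[ℂ] H} (hA : 0 ≤ A) (hu : IsUnit A) :
    ∃ N > 0, (∀ t : ℝ, ‖cfc (fun x : ℝ => (Real.sqrt (t ^ 2 + x))⁻¹) A‖ ≤ N) ∧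
      ∀ t : ℝ, t ≠ 0 →
        ‖cfc (fun x : ℝ => (Real.sqrt (t ^ 2 + x))⁻¹) A - algebraMap ℝ _ |t|⁻¹‖
          ≤ N / |t| ^ 3 := by
  obtain ⟨N, hN, h⟩ := exists_spectrum_bounds hA hu
  have hsa : IsSelfAdjoint A := IsSelfAdjoint.of_nonneg hA
  refine ⟨N, hN, fun t => norm_cfc_le hN.le fun x hx => ?_, fun t ht => ?_⟩
  · obtain ⟨h0, -, h2⟩ := h x hx
    rw [Real.norm_of_nonneg (by positivity)]
    refine le_trans ?_ h2
    have : 0 < Real.sqrt x := Real.sqrt_pos.mpr h0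
    gcongr
    nlinarith [sq_nonneg t]
  · have hτ : 0 < |t| := abs_pos.mpr ht
    rw [← cfc_const (|t|⁻¹) A, ← cfc_sub _ _ A ?_ continuousOn_const]
    · refine norm_cfc_le (by positivity) fun x hx => ?_
      obtain ⟨h0, h1, -⟩ := h x hx
      set r := Real.sqrt (t ^ 2 + x)
      have hr2 : r ^ 2 = |t| ^ 2 + x := by
        rw [Real.sq_sqrt (by positivity), sq_abs]
      have hr : |t| ≤ r := by
        rw [← Real.sqrt_sq_eq_abs]
        exact Real.sqrt_le_sqrt (by linarith)
      have hr0 : 0 < r := hτ.trans_le hr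
      have hle : r⁻¹ ≤ |t|⁻¹ := by gcongr
      rw [Real.norm_eq_abs, abs_sub_comm, abs_of_nonneg (by linarith)]
      have : |t|⁻¹ - r⁻¹ = x / (|t| * r * (r + |t|)) := by
        field_simp
        linarith
      rw [this]
      have hden : |t| ^ 3 ≤ |t| * r * (r + |t|) := by
        calc |t| ^ 3 = |t| * |t| * |t| := by ring
          _ ≤ |t| * r * (r + |t|) := by gcongr; linarith
      gcongr
    · refine ContinuousOn.inv₀ (by fun_prop) fun x hx => ?_
      have := (h x hx).1
      exact (Real.sqrt_pos.mpr (by positivity)).ne'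

theorem norm_le_mul_norm_of_fst_snd {E F : Type*} [SeminormedAddCommGroup E]
    [SeminormedAddCommGroup F] {x y : WithLp 2 (E × F)} {c : ℝ} (hc : 0 ≤ c)
    (h₁ : ‖x.fst‖ ≤ c * ‖y.fst‖) (h₂ : ‖x.snd‖ ≤ c * ‖y.snd‖) : ‖x‖ ≤ c * ‖y‖ := by
  refine (sq_le_sq₀ (norm_nonneg _) (by positivity)).mp ?_
  rw [mul_pow, WithLp.prod_norm_sq_eq_of_L2, WithLp.prod_norm_sq_eq_of_L2]
  have := pow_le_pow_left₀ (norm_nonneg _) h₁ 2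
  have := pow_le_pow_left₀ (norm_nonneg _) h₂ 2
  linarith [mul_pow c ‖y.fst‖ 2, mul_pow c ‖y.snd‖ 2]

theorem exists_norm_LamInv_le {G : H →L[ℂ] H} (hG : IsUnit G) :
    ∃ N > 0, (∀ t w, ‖LamInv G t w‖ ≤ N * ‖w‖) ∧
      ∀ t w, t ≠ 0 → ‖LamInv G t w - |t|⁻¹ • w‖ ≤ N / |t| ^ 3 * ‖w‖ := by
  have hG' : IsUnit (ContinuousLinearMap.adjoint G) := hG.star
  obtain ⟨N₁, hN₁, a₁, b₁⟩ := exists_norm_cfc_inv_sqrt_le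
    (A := G * ContinuousLinearMap.adjoint G) (mul_star_self_nonneg G) (hG.mul hG')
  obtain ⟨N₂, hN₂, a₂, b₂⟩ := exists_norm_cfc_inv_sqrt_le
    (A := ContinuousLinearMap.adjoint G * G) (star_mul_self_nonneg G) (hG'.mul hG)
  have hN : 0 < max N₁ N₂ := lt_max_of_lt_left hN₁
  refine ⟨max N₁ N₂, hN, fun t w => ?_, fun t w ht => ?_⟩
  · apply norm_le_mul_norm_of_fst_snd hN.le
    · exact ContinuousLinearMap.le_of_opNorm_le _ ((a₁ t).trans (le_max_left _ _)) w.fst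
    · exact ContinuousLinearMap.le_of_opNorm_le _ ((a₂ t).trans (le_max_right _ _)) w.snd
  · apply norm_le_mul_norm_of_fst_snd (by positivity)
    · exact ContinuousLinearMap.le_of_opNorm_le _ ((b₁ t ht).trans (by gcongr; simp)) w.fst
    · exact ContinuousLinearMap.le_of_opNorm_le _ ((b₂ t ht).trans (by gcongr; simp)) w.snd

theorem Vop_apply_fst (G : H →L[ℂ] H) (t : ℝ) (w : WithLp 2 (H × H)) :
    (Vop G t w).fst = (t : ℂ) • w.fst + G w.snd := rfl

theorem Vop_apply_snd (G : H →L[ℂ] H) (t : ℝ) (w : WithLp 2 (H × H)) :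
    (Vop G t w).snd = ContinuousLinearMap.adjoint G w.fst - (t : ℂ) • w.snd := rfl

theorem norm_Vop_sq (G : H →L[ℂ] H) (t : ℝ) (w : WithLp 2 (H × H)) :
    ‖Vop G t w‖ ^ 2 = t ^ 2 * ‖w‖ ^ 2 + ‖G w.snd‖ ^ 2
      + ‖ContinuousLinearMap.adjoint G w.fst‖ ^ 2 := by
  rw [WithLp.prod_norm_sq_eq_of_L2, WithLp.prod_norm_sq_eq_of_L2, Vop_apply_fst, Vop_apply_snd,
    @norm_add_sq ℂ, @norm_sub_sq ℂ, norm_smul, norm_smul, inner_smul_left, inner_smul_right,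
    ContinuousLinearMap.adjoint_inner_left]
  simp [mul_pow]
  ring

theorem re_inner_Vop (G : H →L[ℂ] H) (t : ℝ) (w : WithLp 2 (H × H)) :
    (⟪w, Vop G t w⟫_ℂ).re = t * (‖w.fst‖ ^ 2 - ‖w.snd‖ ^ 2) + 2 * (⟪w.fst, G w.snd⟫_ℂ).re := by
  rw [WithLp.prod_inner_apply]
  change (⟪w.fst, (Vop G t w).fst⟫_ℂ + ⟪w.snd, (Vop G t w).snd⟫_ℂ).re = _
  rw [Vop_apply_fst, Vop_apply_snd, inner_add_right, inner_sub_right, inner_smul_right,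
    inner_smul_right, ContinuousLinearMap.adjoint_inner_right, inner_self_eq_norm_sq_to_K,
    inner_self_eq_norm_sq_to_K, Complex.add_re, Complex.add_re, Complex.sub_re,
    ← inner_conj_symm (G w.snd) w.fst, Complex.conj_re]
  simp [← Complex.ofReal_pow]
  ring

theorem norm_Vop_sq_mem_Icc (G : H →L[ℂ] H) (t : ℝ) {w : WithLp 2 (H × H)} (hw : ‖w‖ = 1) :
    ‖Vop G t w‖ ^ 2 ∈ Set.Icc (t ^ 2) (t ^ 2 + ‖G‖ ^ 2) := by
  have hw2 := WithLp.prod_norm_sq_eq_of_L2 w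
  rw [hw] at hw2
  have h1 : ‖G w.snd‖ ^ 2 ≤ ‖G‖ ^ 2 * ‖w.snd‖ ^ 2 := by
    rw [← mul_pow]; exact pow_le_pow_left₀ (norm_nonneg _) (G.le_opNorm _) 2
  have h2 : ‖ContinuousLinearMap.adjoint G w.fst‖ ^ 2 ≤ ‖G‖ ^ 2 * ‖w.fst‖ ^ 2 := by
    rw [← mul_pow, ← LinearIsometryEquiv.norm_map ContinuousLinearMap.adjoint G]
    exact pow_le_pow_left₀ (norm_nonneg _) (ContinuousLinearMap.le_opNorm _ _) 2
  have h3 : ‖G‖ ^ 2 * ‖w.fst‖ ^ 2 + ‖G‖ ^ 2 * ‖w.snd‖ ^ 2 = ‖G‖ ^ 2 := by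
    rw [← mul_add, ← hw2]; ring
  rw [norm_Vop_sq, hw]
  constructor <;> nlinarith [sq_nonneg ‖G w.snd‖, sq_nonneg ‖ContinuousLinearMap.adjoint G w.fst‖]

theorem norm_Vop_le (G : H →L[ℂ] H) (t : ℝ) {w : WithLp 2 (H × H)} (hw : ‖w‖ = 1) :
    ‖Vop G t w‖ ≤ |t| + ‖G‖ := by
  refine (sq_le_sq₀ (norm_nonneg _) (by positivity)).mp ?_
  have h3 : 0 ≤ |t| * ‖G‖ := by positivity
  nlinarith [sq_abs t, (norm_Vop_sq_mem_Icc G t hw).2]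

theorem abs_norm_half_add_sq_sub_le {E : Type*} [NormedAddCommGroup E] [InnerProductSpace ℂ E]
    {v y z : E} {ε β η : ℝ} (hε : ε ^ 2 = 1) (hv : ‖v‖ = 1) (hy : |‖y‖ ^ 2 - 1| ≤ β)
    (hz : ‖z - y‖ ≤ η) :
    |‖(2 : ℂ)⁻¹ • (v + (ε : ℂ) • z)‖ ^ 2 - 1 / 2 * (1 + ε * (⟪v, y⟫_ℂ).re)|
      ≤ β + η * (2 * ‖y‖ + η + 1) := by
  have hε1 : |ε| = 1 := by
    rwa [← abs_one, ← sq_eq_sq_iff_abs_eq_abs, one_pow]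
  have hη := (norm_nonneg _).trans hz
  have key : ‖(2 : ℂ)⁻¹ • (v + (ε : ℂ) • z)‖ ^ 2 - 1 / 2 * (1 + ε * (⟪v, y⟫_ℂ).re)
      = 1 / 4 * (‖y‖ ^ 2 - 1) + 1 / 4 * (‖z‖ ^ 2 - ‖y‖ ^ 2)
        + ε / 2 * (⟪v, z - y⟫_ℂ).re := by
    rw [norm_smul, mul_pow, @norm_add_sq ℂ, norm_smul, mul_pow, inner_smul_right, hv,
      inner_sub_right]
    simp [hε]
    ring
  have h1 : |(⟪v, z - y⟫_ℂ).re| ≤ η := by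
    refine (Complex.abs_re_le_norm _).trans ((norm_inner_le_norm _ _).trans ?_)
    rwa [hv, one_mul]
  have h2 : |‖z‖ ^ 2 - ‖y‖ ^ 2| ≤ η * (2 * ‖y‖ + η) := by
    have h3 := (abs_norm_sub_norm_le z y).trans hz
    have h4 : ‖z‖ + ‖y‖ ≤ 2 * ‖y‖ + η := by linarith [(abs_le.mp h3).2]
    rw [sq_sub_sq, abs_mul, mul_comm, abs_of_nonneg (by positivity : 0 ≤ ‖z‖ + ‖y‖)]
    gcongr
  have h5 : |ε / 2 * (⟪v, z - y⟫_ℂ).re| ≤ η := by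
    rw [abs_mul, abs_div, hε1, abs_two]
    linarith
  have hβ := (abs_nonneg _).trans hy
  have : 0 ≤ η * (2 * ‖y‖ + η) := by positivity
  rw [key]
  rw [abs_le] at hy h2 h5 ⊢
  constructor <;> nlinarith

theorem PiP_apply (G : H →L[ℂ] H) (t : ℝ) (w : WithLp 2 (H × H)) :
    PiP G t w = (2 : ℂ)⁻¹ • (w + ((1 : ℝ) : ℂ) • LamInv G t (Vop G t w)) := by
  simp [PiP]

theorem PiM_apply (G : H →L[ℂ] H) (t : ℝ) (w : WithLp 2 (H × H)) :
    PiM G t w = (2 : ℂ)⁻¹ • (w + ((-1 : ℝ) : ℂ) • LamInv G t (Vop G t w)) := by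
  simp [PiM, sub_eq_add_neg]

/-- For large `|t|`, the masses of the spectral projections of `V(t)` are explicit up to
`O(t⁻²)`; they are bounded locally uniformly in `t`. -/
theorem exists_norm_half_add_LamInv_Vop_le {G : H →L[ℂ] H} (hG : IsUnit G) :
    ∃ C > 0, ∀ ε : ℝ, ε ^ 2 = 1 → ∀ w : WithLp 2 (H × H), ‖w‖ = 1 → ∀ t : ℝ,
      ‖(2 : ℂ)⁻¹ • (w + (ε : ℂ) • LamInv G t (Vop G t w))‖ ^ 2 ≤ C * (1 + |t|) ^ 2 ∧
      (1 ≤ |t| → |‖(2 : ℂ)⁻¹ • (w + (ε : ℂ) • LamInv G t (Vop G t w))‖ ^ 2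
          - 1 / 2 * (1 + ε * (|t|⁻¹ * (t * (‖w.fst‖ ^ 2 - ‖w.snd‖ ^ 2)
            + 2 * (⟪w.fst, G w.snd⟫_ℂ).re)))| ≤ C / t ^ 2) := by
  obtain ⟨N, hN, ha, hb⟩ := exists_norm_LamInv_le hG
  set g := ‖G‖ with hg
  have hg0 : 0 ≤ g := norm_nonneg _
  set n := N * (1 + g) with hn
  have hn0 : 0 < n := by positivity
  refine ⟨(1 + n) ^ 2 + (g ^ 2 + n * (2 * (1 + g) + n + 1)), by positivity, ?_⟩
  intro ε hε w hw t
  have hε1 : |ε| = 1 := by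
    rwa [← abs_one, ← sq_eq_sq_iff_abs_eq_abs, one_pow]
  have hV := norm_Vop_le G t hw
  rw [← hg] at hV
  constructor
  · have h1 : ‖(2 : ℂ)⁻¹ • (w + (ε : ℂ) • LamInv G t (Vop G t w))‖ ≤ (1 + n) * (1 + |t|) := by
      have h2 : ‖LamInv G t (Vop G t w)‖ ≤ n * (1 + |t|) := by
        refine (ha t _).trans ?_
        have h3 : ‖Vop G t w‖ ≤ (1 + g) * (1 + |t|) := by
          nlinarith [mul_nonneg hg0 (abs_nonneg t)]
        calc N * ‖Vop G t w‖ ≤ N * ((1 + g) * (1 + |t|)) := by gcongr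
          _ = _ := by rw [hn]; ring
      have h4 := norm_add_le w ((ε : ℂ) • LamInv G t (Vop G t w))
      rw [norm_smul (ε : ℂ), Complex.norm_real, Real.norm_eq_abs, hε1, hw, one_mul] at h4
      rw [norm_smul, norm_inv, Complex.norm_ofNat]
      nlinarith [abs_nonneg t, norm_nonneg (w + (ε : ℂ) • LamInv G t (Vop G t w))]
    calc _ ≤ ((1 + n) * (1 + |t|)) ^ 2 := pow_le_pow_left₀ (norm_nonneg _) h1 2
      _ = (1 + n) ^ 2 * (1 + |t|) ^ 2 := mul_pow _ _ _
      _ ≤ _ := by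
        gcongr
        exact le_add_of_nonneg_right (by positivity)
  · intro ht
    have ht0 : 0 < |t| := by linarith
    have hVt : ‖Vop G t w‖ ≤ |t| * (1 + g) := by nlinarith
    have hz : ‖LamInv G t (Vop G t w) - |t|⁻¹ • Vop G t w‖ ≤ n / t ^ 2 := by
      refine (hb t _ (abs_pos.mp ht0)).trans ?_
      calc N / |t| ^ 3 * ‖Vop G t w‖ ≤ N / |t| ^ 3 * (|t| * (1 + g)) := by gcongr
        _ = n / |t| ^ 2 := by rw [hn]; field_simp
        _ = n / t ^ 2 := by rw [sq_abs]
    have hyn : ‖|t|⁻¹ • Vop G t w‖ ≤ 1 + g := by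
      rw [norm_smul, Real.norm_of_nonneg (by positivity), inv_mul_le_iff₀ ht0]
      exact hVt
    have hy : |‖|t|⁻¹ • Vop G t w‖ ^ 2 - 1| ≤ g ^ 2 / t ^ 2 := by
      obtain ⟨hl, hu⟩ := norm_Vop_sq_mem_Icc G t hw
      have ht2 : 0 < t ^ 2 := by rw [← sq_abs]; positivity
      have : ‖|t|⁻¹ • Vop G t w‖ ^ 2 - 1 = (‖Vop G t w‖ ^ 2 - t ^ 2) / t ^ 2 := by
        rw [norm_smul, Real.norm_of_nonneg (by positivity), mul_pow, inv_pow, sq_abs, sub_div,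
          div_self ht2.ne', inv_mul_eq_div]
      rw [this, abs_of_nonneg (div_nonneg (by linarith) ht2.le)]
      gcongr
      linarith
    have h := abs_norm_half_add_sq_sub_le hε hw hy hz
    rw [inner_smul_right_eq_smul, Complex.smul_re, re_inner_Vop, smul_eq_mul] at h
    refine h.trans ?_
    have ht2 : 1 ≤ t ^ 2 := by rw [← sq_abs]; nlinarith
    have h1 : n / t ^ 2 ≤ n := div_le_self hn0.le ht2
    calc g ^ 2 / t ^ 2 + n / t ^ 2 * (2 * ‖|t|⁻¹ • Vop G t w‖ + n / t ^ 2 + 1)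
        ≤ g ^ 2 / t ^ 2 + n / t ^ 2 * (2 * (1 + g) + n + 1) := by gcongr
      _ = (g ^ 2 + n * (2 * (1 + g) + n + 1)) / t ^ 2 := by ring
      _ ≤ _ := by
        refine div_le_div_of_nonneg_right ?_ (by positivity)
        exact le_add_of_nonneg_left (by positivity)

/-- Time derivatives of the masses and of the correlation along
`-i p' = α p + G q`, `-i q' = G* p + β q` with `α`, `β` real. -/
theorem hasDerivAt_mass_and_correlation {G : H →L[ℂ] H} {p q : ℝ → H} {α β s : ℝ}
    (hp : HasDerivAt p (Complex.I • ((α : ℂ) • p s + G (q s))) s)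
    (hq : HasDerivAt q
      (Complex.I • (ContinuousLinearMap.adjoint G (p s) + (β : ℂ) • q s)) s) :
    HasDerivAt (fun s => ‖p s‖ ^ 2) (-2 * (⟪p s, G (q s)⟫_ℂ).im) s ∧
    HasDerivAt (fun s => ‖q s‖ ^ 2) (2 * (⟪p s, G (q s)⟫_ℂ).im) s ∧
    HasDerivAt (fun s => (⟪p s, G (q s)⟫_ℂ).re) ((α - β) * (⟪p s, G (q s)⟫_ℂ).im) s ∧
    HasDerivAt (fun s => (⟪p s, G (q s)⟫_ℂ).im) ((β - α) * (⟪p s, G (q s)⟫_ℂ).re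
      + (‖ContinuousLinearMap.adjoint G (p s)‖ ^ 2 - ‖G (q s)‖ ^ 2)) s := by
  have hre : ∀ {f : ℝ → ℂ} {f' : ℂ}, HasDerivAt f f' s → HasDerivAt (fun s => (f s).re) f'.re s :=
    fun h => Complex.reCLM.hasFDerivAt.comp_hasDerivAt s h
  have him : ∀ {f : ℝ → ℂ} {f' : ℂ}, HasDerivAt f f' s → HasDerivAt (fun s => (f s).im) f'.im s :=
    fun h => Complex.imCLM.hasFDerivAt.comp_hasDerivAt s h
  have hGq := (G.restrictScalars ℝ).hasFDerivAt.comp_hasDerivAt s hq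
  have hw := hp.inner ℂ hGq
  have hsq : ∀ x : H, ‖x‖ ^ 2 = (⟪x, x⟫_ℂ).re := fun x => by
    simp [inner_self_eq_norm_sq_to_K, ← Complex.ofReal_pow]
  have hswap : (⟪G (q s), p s⟫_ℂ).im = -(⟪p s, G (q s)⟫_ℂ).im := by
    rw [← inner_conj_symm, Complex.conj_im]
  have hval : ⟪p s, G (Complex.I • (ContinuousLinearMap.adjoint G (p s) + (β : ℂ) • q s))⟫_ℂ
      + ⟪Complex.I • ((α : ℂ) • p s + G (q s)), G (q s)⟫_ℂ
      = Complex.I * (((β - α : ℝ) : ℂ) * ⟪p s, G (q s)⟫_ℂ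
        + ((‖ContinuousLinearMap.adjoint G (p s)‖ ^ 2 - ‖G (q s)‖ ^ 2 : ℝ) : ℂ)) := by
    rw [map_smul, map_add, map_smul, inner_smul_right, inner_add_right, inner_smul_right,
      inner_smul_left, inner_add_left, inner_smul_left, ← ContinuousLinearMap.adjoint_inner_left,
      inner_self_eq_norm_sq_to_K, inner_self_eq_norm_sq_to_K]
    simp
    ring
  refine ⟨?_, ?_, ?_, ?_⟩
  · simp only [hsq]
    refine (hre (hp.inner ℂ hp)).congr_deriv ?_
    rw [inner_smul_left, inner_smul_right, inner_add_left, inner_add_right, inner_smul_left,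
      inner_smul_right]
    simp [hswap]
    ring
  · simp only [hsq]
    refine (hre (hq.inner ℂ hq)).congr_deriv ?_
    rw [inner_smul_left, inner_smul_right, inner_add_left, inner_add_right, inner_smul_left,
      inner_smul_right, ContinuousLinearMap.adjoint_inner_left,
      ContinuousLinearMap.adjoint_inner_right]
    simp [hswap]
    ring
  · refine (hre hw).congr_deriv ((congrArg Complex.re hval).trans ?_)
    simp only [Complex.mul_re, Complex.mul_im, Complex.add_re, Complex.add_im, Complex.ofReal_re,
      Complex.ofReal_im, Complex.I_re, Complex.I_im]
    ring
  · refine (him hw).congr_deriv ((congrArg Complex.im hval).trans ?_)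
    simp only [Complex.mul_re, Complex.mul_im, Complex.add_re, Complex.add_im, Complex.ofReal_re,
      Complex.ofReal_im, Complex.I_re, Complex.I_im]
    ring

theorem IsLZSol.hasDerivAt_fst {G : H →L[ℂ] H} {δ : ℝ} {f₁ f₂ : ℝ × ℝ → ℝ}
    {u : ℝ → WithLp 2 (H × H)} (hu : IsLZSol G δ f₁ f₂ u) (s : ℝ) :
    HasDerivAt (fun s => (u s).fst)
      (Complex.I • (((s + δ * F1 f₁ (u s) : ℝ) : ℂ) • (u s).fst + G (u s).snd)) s := by
  refine ((WithLp.fstL 2 ℝ H H).hasFDerivAt.comp_hasDerivAt s (hu s)).congr_deriv ?_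
  change Complex.I • (((s : ℂ) • (u s).fst + G (u s).snd) + δ • F1 f₁ (u s) • (u s).fst) = _
  rw [smul_smul, ← Complex.coe_smul, Complex.ofReal_add, add_smul]
  abel_nf

theorem IsLZSol.hasDerivAt_snd {G : H →L[ℂ] H} {δ : ℝ} {f₁ f₂ : ℝ × ℝ → ℝ}
    {u : ℝ → WithLp 2 (H × H)} (hu : IsLZSol G δ f₁ f₂ u) (s : ℝ) :
    HasDerivAt (fun s => (u s).snd)
      (Complex.I • (ContinuousLinearMap.adjoint G (u s).fst
        + ((-s + δ * F2 f₂ (u s) : ℝ) : ℂ) • (u s).snd)) s := by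
  refine ((WithLp.sndL 2 ℝ H H).hasFDerivAt.comp_hasDerivAt s (hu s)).congr_deriv ?_
  change Complex.I • ((ContinuousLinearMap.adjoint G (u s).fst - (s : ℂ) • (u s).snd)
    + δ • F2 f₂ (u s) • (u s).snd) = _
  rw [smul_smul, ← Complex.coe_smul, Complex.ofReal_add, add_smul, Complex.ofReal_neg, neg_smul]
  abel_nf

theorem IsLZSol.hasDerivAt_mass_and_correlation {G : H →L[ℂ] H} {δ : ℝ} {f₁ f₂ : ℝ × ℝ → ℝ}
    {u : ℝ → WithLp 2 (H × H)} (hu : IsLZSol G δ f₁ f₂ u) (s : ℝ) :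
    HasDerivAt (fun s => ‖(u s).fst‖ ^ 2) (-2 * (⟪(u s).fst, G (u s).snd⟫_ℂ).im) s ∧
    HasDerivAt (fun s => ‖(u s).snd‖ ^ 2) (2 * (⟪(u s).fst, G (u s).snd⟫_ℂ).im) s ∧
    HasDerivAt (fun s => (⟪(u s).fst, G (u s).snd⟫_ℂ).re)
      (2 * sigma δ f₁ f₂ u s * (⟪(u s).fst, G (u s).snd⟫_ℂ).im) s ∧
    HasDerivAt (fun s => (⟪(u s).fst, G (u s).snd⟫_ℂ).im)
      (-2 * sigma δ f₁ f₂ u s * (⟪(u s).fst, G (u s).snd⟫_ℂ).re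
        + (‖ContinuousLinearMap.adjoint G (u s).fst‖ ^ 2 - ‖G (u s).snd‖ ^ 2)) s := by
  have hσ : 2 * sigma δ f₁ f₂ u s = (s + δ * F1 f₁ (u s)) - (-s + δ * F2 f₂ (u s)) := by
    simp only [sigma, mscal]
    ring
  have h := _root_.hasDerivAt_mass_and_correlation (G := G) (p := fun s => (u s).fst)
    (q := fun s => (u s).snd) (hu.hasDerivAt_fst s) (hu.hasDerivAt_snd s)
  refine ⟨h.1, h.2.1, h.2.2.1.congr_deriv ?_, h.2.2.2.congr_deriv ?_⟩
  · rw [hσ]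
  · rw [neg_mul, hσ, neg_sub]

theorem IsLZSol.norm_eq_one {G : H →L[ℂ] H} {δ : ℝ} {f₁ f₂ : ℝ × ℝ → ℝ}
    {u : ℝ → WithLp 2 (H × H)} (hu : IsLZSol G δ f₁ f₂ u) (h0 : ‖u 0‖ = 1) (s : ℝ) :
    ‖u s‖ = 1 := by
  have hd : ∀ s, HasDerivAt (fun s => ‖u s‖ ^ 2) 0 s := by
    intro s
    obtain ⟨h1, h2, -⟩ := hu.hasDerivAt_mass_and_correlation s
    simp only [WithLp.prod_norm_sq_eq_of_L2]
    exact (h1.add h2).congr_deriv (by ring)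
  have h := is_const_of_deriv_eq_zero (fun s => (hd s).differentiableAt)
    (fun s => (hd s).deriv) s 0
  beta_reduce at h
  rw [h0] at h
  exact (sq_eq_sq₀ (norm_nonneg _) zero_le_one).mp h

/-- Existence of the limits of `‖u₁‖² - ‖u₂‖² + 2 Re ⟪u₁, G u₂⟫ / σ` at `±∞`, with rate. -/
theorem exists_limits_of_isLZSol (G : H →L[ℂ] H) (δ : ℝ) {f₁ f₂ : ℝ × ℝ → ℝ}
    (hf₁ : ContDiff ℝ 2 f₁) (hf₂ : ContDiff ℝ 2 f₂) :
    ∃ C > 0, ∃ D ≥ 0, ∀ u : ℝ → WithLp 2 (H × H), IsLZSol G δ f₁ f₂ u → ‖u 0‖ = 1 →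
      (∀ s, |mscal δ f₁ f₂ (u s)| ≤ D) ∧
      (∃ L ∈ Set.Icc (-1 : ℝ) 1, ∀ s, 2 * (D + 1) ≤ s →
        |‖(u s).fst‖ ^ 2 - ‖(u s).snd‖ ^ 2
          + 2 * (⟪(u s).fst, G (u s).snd⟫_ℂ).re / sigma δ f₁ f₂ u s - L| ≤ C / s ^ 2) ∧
      (∃ L ∈ Set.Icc (-1 : ℝ) 1, ∀ s, s ≤ -(2 * (D + 1)) →
        |‖(u s).fst‖ ^ 2 - ‖(u s).snd‖ ^ 2
          + 2 * (⟪(u s).fst, G (u s).snd⟫_ℂ).re / sigma δ f₁ f₂ u s - L| ≤ C / s ^ 2) := by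
  set g : ℝ → ℝ := fun x => mtilde δ f₁ f₂ (x, 1 - x) with hg_def
  have hg : ContDiff ℝ 2 g := by
    unfold g mtilde
    have h1 : ContDiff ℝ 2 fun x : ℝ => (x, 1 - x) := by fun_prop
    exact contDiff_const.mul ((hf₁.comp h1).sub (hf₂.comp h1))
  have hg' : ContDiff ℝ 1 (deriv g) :=
    (contDiff_succ_iff_deriv.mp (by simpa [one_add_one_eq_two] using hg)).2.2
  have hdg : ∀ x, HasDerivAt g (deriv g x) x := fun x =>
    (hg.differentiable (by norm_num) x).hasDerivAt
  have hdg' : ∀ x, HasDerivAt (deriv g) (deriv (deriv g) x) x := fun x =>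
    (hg'.differentiable (by norm_num) x).hasDerivAt
  obtain ⟨D₀, hD₀⟩ := (isCompact_Icc (a := (0 : ℝ)) (b := 1)).exists_bound_of_continuousOn
    hg.continuous.continuousOn
  obtain ⟨D₁, hD₁⟩ := (isCompact_Icc (a := (0 : ℝ)) (b := 1)).exists_bound_of_continuousOn
    hg'.continuous.continuousOn
  obtain ⟨D₂, hD₂⟩ := (isCompact_Icc (a := (0 : ℝ)) (b := 1)).exists_bound_of_continuousOn
    (hg'.continuous_deriv le_rfl).continuousOn
  set D := |D₀| + |D₁| + |D₂| with hD_def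
  have hD : 0 ≤ D := by positivity
  have hbd : ∀ x ∈ Set.Icc (0 : ℝ) 1, |g x| ≤ D ∧ |deriv g x| ≤ D ∧ |deriv (deriv g) x| ≤ D := by
    intro x hx
    have := le_abs_self D₀
    have := le_abs_self D₁
    have := le_abs_self D₂
    have h0 := hD₀ x hx
    have h1 := hD₁ x hx
    have h2 := hD₂ x hx
    rw [Real.norm_eq_abs] at h0 h1 h2
    refine ⟨?_, ?_, ?_⟩ <;> linarith [abs_nonneg D₀, abs_nonneg D₁, abs_nonneg D₂]
  set B := ‖G‖ + ‖G‖ ^ 2 with hB_def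
  have hB : 0 ≤ B := by positivity
  obtain ⟨C, hC, hmain⟩ := exists_limit_of_mass_system hB hD
  refine ⟨C, hC, D, hD, fun u hu h0 => ?_⟩
  have hnorm := hu.norm_eq_one h0
  have hsum : ∀ s, ‖(u s).fst‖ ^ 2 + ‖(u s).snd‖ ^ 2 = 1 := fun s => by
    rw [← WithLp.prod_norm_sq_eq_of_L2, hnorm, one_pow]
  have ha : ∀ s, ‖(u s).fst‖ ^ 2 ∈ Set.Icc (0 : ℝ) 1 := fun s =>
    ⟨by positivity, by nlinarith [hsum s, sq_nonneg ‖(u s).snd‖]⟩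
  have hb : ∀ s, ‖(u s).snd‖ ^ 2 ≤ 1 := fun s => by
    nlinarith [hsum s, sq_nonneg ‖(u s).fst‖]
  have hm : ∀ s, mscal δ f₁ f₂ (u s) = g (‖(u s).fst‖ ^ 2) := fun s => by
    simp only [hg_def, mscal, mtilde, F1, F2, ← hsum s, add_sub_cancel_left]
  have hp1 : ∀ s, ‖(u s).fst‖ ≤ 1 := fun s =>
    (sq_le_one_iff₀ (norm_nonneg _)).mp (ha s).2
  have hq1 : ∀ s, ‖(u s).snd‖ ≤ 1 := fun s => (sq_le_one_iff₀ (norm_nonneg _)).mp (hb s)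
  have hGq : ∀ s, ‖G (u s).snd‖ ≤ ‖G‖ := fun s => G.unit_le_opNorm _ (hq1 s)
  have hGp : ∀ s, ‖ContinuousLinearMap.adjoint G (u s).fst‖ ≤ ‖G‖ := fun s => by
    rw [← LinearIsometryEquiv.norm_map ContinuousLinearMap.adjoint G]
    exact ContinuousLinearMap.unit_le_opNorm _ _ (hp1 s)
  have hw : ∀ s, ‖⟪(u s).fst, G (u s).snd⟫_ℂ‖ ≤ B := fun s => by
    refine (norm_inner_le_norm _ _).trans ?_
    nlinarith [mul_le_mul (hp1 s) (hGq s) (norm_nonneg _) zero_le_one, sq_nonneg ‖G‖]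
  have hκ : ∀ s, |‖ContinuousLinearMap.adjoint G (u s).fst‖ ^ 2 - ‖G (u s).snd‖ ^ 2| ≤ B := by
    intro s
    have h1 := pow_le_pow_left₀ (norm_nonneg _) (hGq s) 2
    have h2 := pow_le_pow_left₀ (norm_nonneg _) (hGp s) 2
    have h3 := norm_nonneg G
    rw [abs_le]
    constructor <;>
    nlinarith [sq_nonneg ‖G (u s).snd‖, sq_nonneg ‖ContinuousLinearMap.adjoint G (u s).fst‖]
  have hX := fun s => (Complex.abs_re_le_norm _).trans (hw s)
  have hY := fun s => (Complex.abs_im_le_norm _).trans (hw s)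
  have hode := fun s => hu.hasDerivAt_mass_and_correlation s
  have hdiff : ∀ s, ‖(u s).fst‖ ^ 2 - ‖(u s).snd‖ ^ 2 = 2 * ‖(u s).fst‖ ^ 2 - 1 := fun s => by
    linarith [hsum s]
  refine ⟨fun s => (hm s).symm ▸ (hbd _ (ha s)).1, ?_, ?_⟩
  · simp only [hdiff]
    refine hmain g (deriv g) (deriv (deriv g)) (fun s => ‖(u s).fst‖ ^ 2) _ _ _
      (sigma δ f₁ f₂ u) hdg hdg' hbd ha hX hY hκ (fun s => ?_) (fun s => (hode s).1)
      (fun s => (hode s).2.2.1) (fun s => (hode s).2.2.2)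
    rw [sigma, hm]
  · simp only [hdiff]
    have hrev : ∀ {f : ℝ → ℝ} {f' : ℝ} {s : ℝ}, HasDerivAt f f' (-s) →
        HasDerivAt (fun s => f (-s)) (-f') s := fun {f f' s} h =>
      HasDerivAt.congr_deriv (h.comp s (hasDerivAt_neg s)) (mul_neg_one f')
    obtain ⟨L, hL, hlim⟩ := hmain (fun x => -g x) (fun x => -deriv g x)
      (fun x => -deriv (deriv g) x) (fun s => ‖(u (-s)).fst‖ ^ 2)
      (fun s => -(⟪(u (-s)).fst, G (u (-s)).snd⟫_ℂ).re)
      (fun s => -(⟪(u (-s)).fst, G (u (-s)).snd⟫_ℂ).im)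
      (fun s => ‖ContinuousLinearMap.adjoint G (u (-s)).fst‖ ^ 2 - ‖G (u (-s)).snd‖ ^ 2)
      (fun s => -sigma δ f₁ f₂ u (-s)) (fun x => (hdg x).neg) (fun x => (hdg' x).neg)
      (fun x hx => by simpa only [abs_neg] using hbd x hx) (fun s => ha (-s))
      (fun s => by simpa only [abs_neg] using hX (-s))
      (fun s => by simpa only [abs_neg] using hY (-s)) (fun s => hκ (-s))
      (fun s => by rw [sigma, hm]; ring)
      (fun s => (hrev (hode (-s)).1).congr_deriv (by ring))
      (fun s => (hrev (hode (-s)).2.2.1).neg.congr_deriv (by ring))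
      (fun s => (hrev (hode (-s)).2.2.2).neg.congr_deriv (by ring))
    refine ⟨L, hL, fun s hs => ?_⟩
    have := hlim (-s) (by linarith)
    simpa only [neg_neg, neg_sq, mul_neg, neg_div_neg_eq] using this

theorem abs_sub_half_le_of_abs_sub_le {P y L ε s σ C₁ C₂ : ℝ} (hε : ε ^ 2 = 1) (hs : 0 < s ^ 2)
    (hσ : s ^ 2 ≤ 4 * σ ^ 2) (hC₁ : 0 ≤ C₁) (hC₂ : 0 ≤ C₂)
    (hP : |P - 1 / 2 * (1 + ε * y)| ≤ C₁ / σ ^ 2) (hy : |y - L| ≤ C₂ / s ^ 2) :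
    |P - 1 / 2 * (1 + ε * L)| ≤ (4 * C₁ + C₂) / s ^ 2 := by
  have hσ0 : 0 < σ ^ 2 := by linarith
  have h1 : C₁ / σ ^ 2 ≤ 4 * C₁ / s ^ 2 := by
    rw [div_le_div_iff₀ hσ0 hs]
    nlinarith
  have h2 : |ε * (y - L)| ≤ C₂ / s ^ 2 := by
    rwa [abs_mul, (sq_eq_sq_iff_abs_eq_abs ε 1).mp (by rw [hε, one_pow]), abs_one, one_mul]
  have h3 : 0 ≤ C₂ / s ^ 2 := by positivity
  rw [add_div]
  rw [abs_le] at hP h2 ⊢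
  constructor <;> nlinarith

theorem exists_limits_of_norm_projections {G : H →L[ℂ] H} (hG : IsUnit G) (δ : ℝ)
    {f₁ f₂ : ℝ × ℝ → ℝ} (hf₁ : ContDiff ℝ 2 f₁) (hf₂ : ContDiff ℝ 2 f₂) :
    ∃ C > 0, ∀ u : ℝ → WithLp 2 (H × H), IsLZSol G δ f₁ f₂ u → ‖u 0‖ = 1 →
      ∀ c : ℝ → ℂ, (∀ s, ‖c s‖ = 1) →
      ∃ L ∈ Set.Icc (-1 : ℝ) 1, ∃ L' ∈ Set.Icc (-1 : ℝ) 1, ∀ ε : ℝ, ε ^ 2 = 1 →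
        (∀ s, 1 ≤ s →
          |‖(2 : ℂ)⁻¹ • (c s • u s + (ε : ℂ) • LamInv G (sigma δ f₁ f₂ u s)
            (Vop G (sigma δ f₁ f₂ u s) (c s • u s)))‖ ^ 2 - 1 / 2 * (1 + ε * L)| ≤ C / s ^ 2) ∧
        (∀ s, s ≤ -1 →
          |‖(2 : ℂ)⁻¹ • (c s • u s + (ε : ℂ) • LamInv G (sigma δ f₁ f₂ u s)
            (Vop G (sigma δ f₁ f₂ u s) (c s • u s)))‖ ^ 2 - 1 / 2 * (1 + ε * L')|
            ≤ C / s ^ 2) := by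
  obtain ⟨C₁, hC₁, hproj⟩ := exists_norm_half_add_LamInv_Vop_le hG
  obtain ⟨C₂, hC₂, D, hD, hlim⟩ := exists_limits_of_isLZSol G δ hf₁ hf₂
  set T := 2 * (D + 1) with hT
  have hT0 : 0 < T := by positivity
  set C₃ := C₁ * (1 + (T + D)) ^ 2 + 1 with hC₃
  refine ⟨4 * C₁ + C₂ + C₃ * T ^ 2, by positivity, fun u hu h0 c hc => ?_⟩
  obtain ⟨hm, ⟨L₁, hL₁, hlim₁⟩, L₂, hL₂, hlim₂⟩ := hlim u hu h0
  refine ⟨L₁, hL₁, -L₂, ⟨by linarith [hL₂.2], by linarith [hL₂.1]⟩, fun ε hε => ?_⟩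
  have hε1 : |ε| = 1 := by
    rwa [← abs_one, ← sq_eq_sq_iff_abs_eq_abs, one_pow]
  set σ := sigma δ f₁ f₂ u with hσ
  set P : ℝ → ℝ := fun s => ‖(2 : ℂ)⁻¹ • (c s • u s + (ε : ℂ) • LamInv G (σ s)
    (Vop G (σ s) (c s • u s)))‖ ^ 2 with hP
  have hw : ∀ s, ‖c s • u s‖ = 1 := fun s => by rw [norm_smul, hc, hu.norm_eq_one h0, mul_one]
  have hfst : ∀ s, ‖(c s • u s).fst‖ = ‖(u s).fst‖ := fun s => by
    rw [WithLp.smul_fst, norm_smul, hc, one_mul]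
  have hsnd : ∀ s, ‖(c s • u s).snd‖ = ‖(u s).snd‖ := fun s => by
    rw [WithLp.smul_snd, norm_smul, hc, one_mul]
  have hinner : ∀ s, ⟪(c s • u s).fst, G (c s • u s).snd⟫_ℂ = ⟪(u s).fst, G (u s).snd⟫_ℂ := by
    intro s
    rw [WithLp.smul_fst, WithLp.smul_snd, map_smul, inner_smul_left, inner_smul_right, ← mul_assoc,
      Complex.conj_mul', hc]
    simp
  have hσs : ∀ s, |σ s - s| ≤ D := fun s => by
    simpa only [hσ, sigma, add_sub_cancel_left] using hm s
  have hmiddle : ∀ s, 1 ≤ |s| → |s| ≤ T → ∀ y, |y| ≤ 1 →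
      |P s - 1 / 2 * (1 + ε * y)| ≤ (4 * C₁ + C₂ + C₃ * T ^ 2) / s ^ 2 := by
    intro s hs hsT y hy
    have hσT : |σ s| ≤ T + D := by
      have := abs_add_le (σ s - s) s
      rw [sub_add_cancel] at this
      linarith [hσs s]
    have h1 : P s ≤ C₁ * (1 + (T + D)) ^ 2 := by
      refine ((hproj ε hε _ (hw s) (σ s)).1).trans ?_
      gcongr
    have h2 : 0 ≤ P s := sq_nonneg _
    have h3 : |ε * y| ≤ 1 := by rwa [abs_mul, hε1, one_mul]
    have h4 : |P s - 1 / 2 * (1 + ε * y)| ≤ C₃ := by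
      rw [abs_le] at h3 ⊢
      constructor <;> linarith
    have hs2 : 0 < s ^ 2 := by rw [← sq_abs]; positivity
    have hsT2 : s ^ 2 ≤ T ^ 2 := by
      rw [← sq_abs]; exact pow_le_pow_left₀ (abs_nonneg _) hsT 2
    rw [le_div_iff₀ hs2]
    calc _ ≤ C₃ * T ^ 2 := by gcongr
      _ ≤ _ := by linarith
  have hfar : ∀ s, T ≤ |s| → |s| ≤ 2 * |σ s| ∧
      |P s - 1 / 2 * (1 + ε * (|σ s|⁻¹ * (σ s * (‖(u s).fst‖ ^ 2 - ‖(u s).snd‖ ^ 2)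
        + 2 * (⟪(u s).fst, G (u s).snd⟫_ℂ).re)))| ≤ C₁ / σ s ^ 2 := by
    intro s hs
    have h1 : |s| ≤ 2 * |σ s| := by
      have := abs_sub_abs_le_abs_sub s (σ s)
      rw [abs_sub_comm] at this
      linarith [hσs s]
    have h2 := (hproj ε hε _ (hw s) (σ s)).2 (by linarith)
    rw [hfst, hsnd, hinner] at h2
    exact ⟨h1, h2⟩
  have htail : ∀ s y L, T ≤ |s| → |σ s|⁻¹ * (σ s * (‖(u s).fst‖ ^ 2 - ‖(u s).snd‖ ^ 2)
        + 2 * (⟪(u s).fst, G (u s).snd⟫_ℂ).re) = y → |y - L| ≤ C₂ / s ^ 2 →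
      |P s - 1 / 2 * (1 + ε * L)| ≤ (4 * C₁ + C₂ + C₃ * T ^ 2) / s ^ 2 := by
    intro s y L hs hy hyL
    obtain ⟨h1, h2⟩ := hfar s hs
    have hs2 : 0 < s ^ 2 := by rw [← sq_abs]; exact pow_pos (hT0.trans_le hs) 2
    have h3 : s ^ 2 ≤ 4 * σ s ^ 2 := by
      have := pow_le_pow_left₀ (abs_nonneg _) h1 2
      rw [mul_pow, sq_abs, sq_abs] at this
      linarith
    rw [hy] at h2
    refine (abs_sub_half_le_of_abs_sub_le hε hs2 h3 hC₁.le hC₂.le h2 hyL).trans ?_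
    refine div_le_div_of_nonneg_right ?_ hs2.le
    exact le_add_of_nonneg_right (by positivity)
  constructor
  · intro s hs
    have hs0 : |s| = s := abs_of_pos (by linarith)
    rcases le_total s T with h | h
    · exact hmiddle s (by rwa [hs0]) (by rwa [hs0]) _ (abs_le.mpr hL₁)
    · have hσ0 : 0 < σ s := by linarith [(abs_le.mp (hσs s)).1]
      refine htail s _ _ (by rwa [hs0]) ?_ (hlim₁ s h)
      rw [abs_of_pos hσ0, mul_add, inv_mul_cancel_left₀ hσ0.ne', inv_mul_eq_div]
  · intro s hs
    have hs0 : |s| = -s := abs_of_neg (by linarith)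
    rcases le_total (-s) T with h | h
    · exact hmiddle s (by rw [hs0]; linarith) (by rwa [hs0]) _
        (by rw [abs_neg]; exact abs_le.mpr hL₂)
    · have hσ0 : σ s < 0 := by linarith [(abs_le.mp (hσs s)).2]
      refine htail s (-(‖(u s).fst‖ ^ 2 - ‖(u s).snd‖ ^ 2
        + 2 * (⟪(u s).fst, G (u s).snd⟫_ℂ).re / σ s)) _ (by rwa [hs0]) ?_
        (by rw [neg_sub_neg, abs_sub_comm]; exact hlim₂ s (by linarith))
      rw [abs_of_neg hσ0]
      have := hσ0.ne
      field_simp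

/-- convergence of the masses of the projected components `v^± = Π^± v`
(Proposition 4.1). -/
theorem stmt_15 {K : Type*} [NormedAddCommGroup K] [InnerProductSpace ℂ K]
    [FiniteDimensional ℂ K]
    (G : K →L[ℂ] K) (hG : CommHyp G) (hGu : IsUnit G) (δ : ℝ) (f₁ f₂ : ℝ × ℝ → ℝ)
    (hf₁ : C2Bdd f₁) (hf₂ : C2Bdd f₂) (θ : ℝ → ℝ) (hθ : IsCutoff θ)
    (R : ℝ) (hR : 0 < R) :
    ∃ C > 0, ∀ u₀ : WithLp 2 (K × K), ∀ u : ℝ → WithLp 2 (K × K),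
      Theta G θ R u₀ = u₀ → ‖u₀.fst‖ ^ 2 + ‖u₀.snd‖ ^ 2 = 1 →
      IsLZSol G δ f₁ f₂ u → u 0 = u₀ →
      ∀ v : ℝ → WithLp 2 (K × K), v = gaugeT δ f₁ f₂ u →
      ∃ Ωp Ωm Ap Am : ℝ,
        Ωp ∈ Set.Icc (0 : ℝ) 1 ∧ Ωm ∈ Set.Icc (0 : ℝ) 1 ∧
        Ap ∈ Set.Icc (0 : ℝ) 1 ∧ Am ∈ Set.Icc (0 : ℝ) 1 ∧
        (∀ s : ℝ, 1 ≤ s →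
          |‖PiP G (sigma δ f₁ f₂ u s) (v s)‖ ^ 2 - Ωp| ≤ C / s ^ 2 ∧
          |‖PiM G (sigma δ f₁ f₂ u s) (v s)‖ ^ 2 - Ωm| ≤ C / s ^ 2) ∧
        (∀ s : ℝ, s ≤ -1 →
          |‖PiP G (sigma δ f₁ f₂ u s) (v s)‖ ^ 2 - Ap| ≤ C / s ^ 2 ∧
          |‖PiM G (sigma δ f₁ f₂ u s) (v s)‖ ^ 2 - Am| ≤ C / s ^ 2) := by
  obtain ⟨C, hC, h⟩ := exists_limits_of_norm_projections hGu δ hf₁.1 hf₂.1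
  refine ⟨C, hC, fun u₀ u _ hu₀ hu h0 v hv => ?_⟩
  subst hv
  have hnorm : ‖u 0‖ = 1 := by
    rw [← sq_eq_sq₀ (norm_nonneg _) zero_le_one, WithLp.prod_norm_sq_eq_of_L2, h0, hu₀, one_pow]
  obtain ⟨L, hL, L', hL', hlim⟩ := h u hu hnorm
    (fun s => Complex.exp (-(Complex.I * (∫ τ in (0:ℝ)..s, Mscal δ f₁ f₂ (u τ))))) (fun s => by
      simp [Complex.norm_exp])
  have hp := hlim 1 (by norm_num)
  have hm := hlim (-1) (by norm_num)
  refine ⟨1 / 2 * (1 + 1 * L), 1 / 2 * (1 + -1 * L), 1 / 2 * (1 + 1 * L'), 1 / 2 * (1 + -1 * L'),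
    ?_, ?_, ?_, ?_, fun s hs => ?_, fun s hs => ?_⟩
  · constructor <;> linarith [hL.1, hL.2]
  · constructor <;> linarith [hL.1, hL.2]
  · constructor <;> linarith [hL'.1, hL'.2]
  · constructor <;> linarith [hL'.1, hL'.2]
  · rw [PiP_apply, PiM_apply]
    exact ⟨hp.1 s hs, hm.1 s hs⟩
  · rw [PiP_apply, PiM_apply]
    exact ⟨hp.2 s hs, hm.2 s hs⟩

end
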